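/- arXiv:1409.3782 — 2 statements merged into one kernel-verified Lean document; each statement's English description precedes it below -/
import Mathlib

section
/- Assume h/k ∈ 𝒬_{a,b,A,B}. Then for every integer n ≥ 1 one has #{j ∈ {0,…,n−1} : ζ_b^aζ_k^{h(A+Bj)} = 1} + #{j ∈ {0,…,n−1} : ζ_b^{−a}ζ_k^{h(B−A+Bj)} = 1} ≥ #{m ∈ {1,…,n} : ζ_k^{hBm} = −1} + ⌊n/k'⌋. (The left side is the order of vanishing of the numerator (ζ_b^aζ_k^{hA};ζ_k^{hB})_n (ζ_b^{−a}ζ_k^{h(B−A)};ζ_k^{hB})_n of the n-th term of L, the first summand on the right the order of vanishing of its denominator (−ζ_k^{hB};ζ_k^{hB})_n; hence the series L(ζ_b^aζ_k^{hA};ζ_k^{hB}) terminates after the term n = k'−1.) -/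
open scoped BigOperators Classical
open Filter Topology

noncomputable section

/-- finite q-Pochhammer symbol $(x;q)_n$ -/
def qPoch (x q : ℂ) (n : ℕ) : ℂ := ∏ j ∈ Finset.range n, (1 - x * q ^ j)

/-- infinite q-Pochhammer symbol $(x;q)_\infty$ -/
def qPochInf (x q : ℂ) : ℂ := ∏' j : ℕ, (1 - x * q ^ j)

/-- $e(x) = e^{2\pi i x}$ -/
def ee (x : ℂ) : ℂ := Complex.exp (2 * Real.pi * Complex.I * x)

/-- $\zeta_n^m = e(m/n)$ -/
def zeta (m : ℤ) (n : ℕ) : ℂ := ee ((m : ℂ) / (n : ℂ))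

/-- Dedekind eta -/
def eta (τ : ℂ) : ℂ := Complex.exp (Real.pi * Complex.I * τ / 12) * qPochInf (ee τ) (ee τ)

/-- Jacobi theta -/
def theta (z τ : ℂ) : ℂ :=
  -Complex.I * Complex.exp (Real.pi * Complex.I * τ / 4) * Complex.exp (-(Real.pi * Complex.I * z))
    * qPochInf (ee τ) (ee τ) * qPochInf (ee z) (ee τ) * qPochInf ((ee z)⁻¹ * ee τ) (ee τ)

/-- universal mock theta function g₂ -/
def g2 (ζ q : ℂ) : ℂ :=
  ∑' n : ℕ, qPoch (-q) q n * q ^ (n * (n + 1) / 2) /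
    (qPoch ζ q (n + 1) * qPoch (ζ⁻¹ * q) q (n + 1))

/-- universal mock theta function g₃ -/
def g3 (ζ q : ℂ) : ℂ :=
  ∑' n : ℕ, q ^ (n * (n + 1)) / (qPoch ζ q (n + 1) * qPoch (ζ⁻¹ * q) q (n + 1))

/-- the series L -/
def Lser (ζ q : ℂ) : ℂ :=
  (1 / 2) * ∑' n : ℕ, q ^ n * qPoch (ζ⁻¹ * q) q n * qPoch ζ q n / qPoch (-q) q n

/-- the function M -/
def Mfun (z τ : ℂ) : ℂ :=
  -(Complex.I / 2) * Complex.exp (Real.pi * Complex.I * z) * theta z τ *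
    g3 (-(ee z)) (ee τ) / (Complex.exp (Real.pi * Complex.I * τ / 12) * eta (2 * τ))

/-- the function T -/
def Tfun (z τ : ℂ) : ℂ :=
  -Complex.I * eta (2 * τ) ^ 4 / (ee z * eta τ ^ 2 * theta (2 * z) (2 * τ))
  - Complex.I * eta (2 * τ) ^ 10 * theta (2 * z + 1 / 2) (2 * τ) /
      (2 * ee z ^ 2 * Complex.exp (Real.pi * Complex.I * τ / 2) * eta τ ^ 4 * eta (4 * τ) ^ 4 *
        theta (2 * z) (2 * τ) * theta (2 * z + τ + 1 / 2) (2 * τ))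
  - Complex.I * eta (2 * τ) ^ 4 * theta z τ /
      (2 * Complex.exp (Real.pi * Complex.I * τ / 2) * ee z ^ 2 * eta (4 * τ) ^ 2 *
        theta (z + 1 / 2) τ * theta (2 * z + τ + 1 / 2) (2 * τ))

/-- the function K -/
def Kfun (z τ : ℂ) : ℂ :=
  eta (2 * τ) ^ 4 / (Complex.I * ee z * eta τ ^ 2 * theta (2 * z) (2 * τ))

/-- Zwegers' μ-function -/
def mu (z₁ z₂ τ : ℂ) : ℂ :=
  Complex.exp (Real.pi * Complex.I * z₁) / theta z₂ τ *
    ∑' n : ℤ, (-(ee z₂)) ^ n * Complex.exp (Real.pi * Complex.I * (n : ℂ) * ((n : ℂ) + 1) * τ) /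
      (1 - ee z₁ * (ee τ) ^ n)

/-- the Appell–Lerch sum A -/
def appell (ζ q : ℂ) : ℂ :=
  ∑' n : ℤ, (-1 : ℂ) ^ n * q ^ ((3 * n * (n + 1)) / 2) / (1 + ζ * q ^ n)

/-- the function Θ -/
def bigTheta (z₁ z₂ z τ : ℂ) : ℂ :=
  (1 / (2 * Real.pi * Complex.I)) * deriv (fun w => theta w τ) 0 *
    theta (z₁ + z₂ + z) τ * theta z τ /
    (theta z₁ τ * theta z₂ τ * theta (z₁ + z) τ * theta (z₂ + z) τ)

/-- the function 𝔱 -/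
def tfrak (z τ : ℂ) : ℂ :=
  Kfun z τ - Complex.I * Kfun (z + 1 / 4) (τ + 1 / 2) +
    Complex.I * Complex.exp (-(Real.pi * Complex.I * τ / 2)) * bigTheta (2 * z) τ (1 / 2) (2 * τ)

/-- the second order mock theta function B -/
def mockB (q : ℂ) : ℂ :=
  ∑' n : ℕ, q ^ n * qPoch (-q) (q ^ 2) n / qPoch q (q ^ 2) (n + 1)

/-- Ramanujan's third order mock theta function f -/
def mockf (q : ℂ) : ℂ := ∑' n : ℕ, q ^ (n ^ 2) / qPoch (-q) q n ^ 2

/-- the modular form b -/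
def bfun (q : ℂ) : ℂ := qPochInf q q / qPochInf (-q) q ^ 2

/-- τ(t) = h/k + it/(2π) -/
def tauT (h k : ℕ) (t : ℝ) : ℂ := (h : ℂ) / (k : ℂ) + Complex.I * (t : ℂ) / (2 * Real.pi)

/-- q(t) = e^{2πiτ(t)} -/
def qT (h k : ℕ) (t : ℝ) : ℂ := ee (tauT h k t)

theorem zeta_eq_one_iff {n : ℕ} (hn : 0 < n) (m : ℤ) : zeta m n = 1 ↔ (n : ℤ) ∣ m := by
  have hn' : (n : ℂ) ≠ 0 := by exact_mod_cast hn.ne'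
  unfold zeta ee
  rw [Complex.exp_eq_one_iff]
  refine exists_congr fun t => ?_
  rw [show 2 * (Real.pi : ℂ) * Complex.I * ((m : ℂ) / n) = (m : ℂ) / n * (2 * Real.pi * Complex.I)
    by ring, mul_left_inj' Complex.two_pi_I_ne_zero, div_eq_iff hn', mul_comm (t : ℂ)]
  norm_cast

theorem zeta_add (x y : ℤ) (n : ℕ) : zeta (x + y) n = zeta x n * zeta y n := by
  unfold zeta ee
  rw [← Complex.exp_add]
  congr 1
  push_cast
  ring

theorem zeta_mul_mul_right (x : ℤ) (n : ℕ) {d : ℕ} (hd : 0 < d) :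
    zeta (x * d) (n * d) = zeta x n := by
  have hd' : (d : ℂ) ≠ 0 := by exact_mod_cast hd.ne'
  unfold zeta
  push_cast
  rw [mul_div_mul_right _ _ hd']

theorem dvd_two_mul_of_zeta_eq_neg_one {n : ℕ} (hn : 0 < n) {m : ℤ} (h : zeta m n = -1) :
    (n : ℤ) ∣ 2 * m ∧ ¬ (n : ℤ) ∣ m := by
  rw [← zeta_eq_one_iff hn, ← zeta_eq_one_iff hn, two_mul, zeta_add, h]
  norm_num

theorem card_filter_range_modEq {r : ℕ} (hr : 0 < r) (v n : ℕ) :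
    ((Finset.range n).filter (· ≡ v [MOD r])).card =
      n / r + if v % r < n % r then 1 else 0 := by
  rw [← Nat.count_modEq_card n hr v, Nat.count_eq_card_filter_range]

theorem le_card_filter_range_of_modEq {r : ℕ} (hr : 0 < r) (v n : ℕ) {P : ℕ → Prop}
    (hP : ∀ j, j ≡ v [MOD r] → P j) :
    (n / r + if v % r < n % r then 1 else 0) ≤ ((Finset.range n).filter P).card := by
  rw [← card_filter_range_modEq hr]
  exact Finset.card_le_card (Finset.monotone_filter_right _ fun j _ hj => hP j hj)

/-- Solvability of `c + x * j ≡ 0 (mod g * r)` in `j`, when `x / g` is invertible modulo `r`. -/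
theorem exists_lt_mul_dvd_add_mul {r g : ℕ} (hr : 0 < r) {c x : ℤ} (hx : IsCoprime x (r : ℤ))
    (hc : (g : ℤ) ∣ c) : ∃ j < r, ((g * r : ℕ) : ℤ) ∣ c + g * x * (j : ℤ) := by
  obtain ⟨c, rfl⟩ := hc
  obtain ⟨u, w, huw⟩ := hx
  have hr' : (0 : ℤ) < r := by exact_mod_cast hr
  have hnonneg := Int.emod_nonneg (-c * u) hr'.ne'
  refine ⟨((-c * u) % r).toNat, by have := Int.emod_lt_of_pos (-c * u) hr'; omega, ?_⟩
  rw [Int.toNat_of_nonneg hnonneg, Int.emod_def]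
  refine ⟨c * w - x * ((-c * u) / r), ?_⟩
  push_cast
  linear_combination (-(g : ℤ) * c) * huw

/-- The `m` with `x * m ≡ r / 2 (mod r)`, counted in `{1, …, n}`. -/
theorem card_filter_Icc_le {r g : ℕ} (hr : 0 < r) (hg : 0 < g) {x : ℤ} (hx : IsCoprime x (r : ℤ))
    (n : ℕ) {P : ℕ → Prop}
    (hP : ∀ m, P m → ((g * r : ℕ) : ℤ) ∣ 2 * (g * x * (m : ℤ)) ∧
      ¬ ((g * r : ℕ) : ℤ) ∣ g * x * (m : ℤ)) :
    ((Finset.Icc 1 n).filter P).card ≤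
      if r % 2 = 0 then n / r + (if (r / 2 - 1) % r < n % r then 1 else 0) else 0 := by
  have hg' : (g : ℤ) ≠ 0 := by exact_mod_cast hg.ne'
  have key : ∀ m, P m → r ∣ 2 * m ∧ ¬ r ∣ m := by
    intro m hm
    obtain ⟨h1, h2⟩ := hP m hm
    push_cast at h1 h2
    rw [show 2 * (g * x * (m : ℤ)) = g * (x * (2 * m : ℤ)) by ring,
      mul_dvd_mul_iff_left hg'] at h1
    rw [mul_assoc, mul_dvd_mul_iff_left hg'] at h2
    refine ⟨by exact_mod_cast hx.symm.dvd_of_dvd_mul_left h1, fun h => h2 ?_⟩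
    exact (Int.natCast_dvd_natCast.2 h).mul_left x
  by_cases hpar : r % 2 = 0
  · obtain ⟨l, rfl⟩ : ∃ l, r = 2 * l := ⟨r / 2, by omega⟩
    rw [if_pos hpar, Nat.mul_div_cancel_left l two_pos, ← card_filter_range_modEq hr]
    refine Finset.card_le_card_of_injOn (· - 1) (fun m hm => ?_) (fun m hm m' hm' hmm => ?_)
    · simp only [Finset.coe_filter, Finset.mem_Icc, Set.mem_ofPred_eq, Finset.mem_range] at hm ⊢
      refine ⟨by omega, ?_⟩
      obtain ⟨⟨w, hw⟩, h2⟩ := key m hm.2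
      obtain rfl : m = l * w := by linarith
      obtain ⟨v, rfl | rfl⟩ := w.even_or_odd'
      · exact absurd ⟨v, by ring⟩ h2
      · rw [show l * (2 * v + 1) - 1 = l - 1 + 2 * l * v by
          rw [show l * (2 * v + 1) = l + 2 * l * v by ring]; omega]
        simp [Nat.ModEq]
    · simp only [Finset.coe_filter, Finset.mem_Icc, Set.mem_ofPred_eq] at hm hm' hmm
      omega
  · rw [if_neg hpar, Nat.le_zero, Finset.card_eq_zero, Finset.filter_eq_empty_iff]
    intro m _ hm
    obtain ⟨h1, h2⟩ := key m hm
    have : Nat.Coprime r 2 := by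
      rw [Nat.coprime_two_right, Nat.odd_iff]; omega
    exact h2 (this.dvd_of_dvd_mul_left h1)

/-- Counting over the image of a finite set of naturals in `ℤ`, in the form produced by the
monadic coercion `Finset ℕ → Finset ℤ`. -/
theorem card_filter_bind_pure_natCast (s : Finset ℕ) (P : ℤ → Prop) :
    ((do let a ← s; pure (a : ℤ) : Finset ℤ).filter P).card =
      (s.filter fun a : ℕ => P (a : ℤ)).card := by
  have hs : (do let a ← s; pure (a : ℤ) : Finset ℤ) = s.map Nat.castEmbedding := by
    ext x
    simp [eq_comm]
  rw [hs, Finset.filter_map, Finset.card_map]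
  rfl

/-- Lemma 4.1: the series L terminates at cusps in 𝒬. -/
theorem statement4 (a b A B h k : ℕ) (hb : 1 ≤ b) (hB : 1 ≤ B) (hk : 1 ≤ k)
    (hab : a < b) (hAB : A < B) (hhk : h < k)
    (hgab : Nat.gcd a b = 1) (hgAB : Nat.gcd A B = 1) (hghk : Nat.gcd h k = 1)
    (hQ : b ∣ k ∧ Nat.gcd B k ∣ (a * (k / b) + h * A)) :
    ∀ n : ℕ, 1 ≤ n →
      ((Finset.Icc 1 n).filter
          (fun m => zeta ((h : ℤ) * (B : ℤ) * (m : ℤ)) k = -1)).card +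
        n / (k / Nat.gcd k B) ≤
      ((Finset.range n).filter
          (fun j => zeta a b * zeta ((h : ℤ) * ((A : ℤ) + (B : ℤ) * (j : ℤ))) k = 1)).card +
      ((Finset.range n).filter
          (fun j => zeta (-(a : ℤ)) b * zeta ((h : ℤ) * ((B : ℤ) - (A : ℤ) + (B : ℤ) * (j : ℤ))) k = 1)).card := by
  intro n _
  obtain ⟨⟨d, hkd⟩, hQ⟩ := hQ
  have hd : 0 < d := Nat.pos_of_ne_zero fun h0 => by simp [h0] at hkd; omega
  rw [hkd, Nat.mul_div_cancel_left d hb, ← hkd, Nat.gcd_comm] at hQ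
  have hg : 0 < Nat.gcd k B := Nat.gcd_pos_of_pos_left _ hk
  obtain ⟨r, B', hcop, hkr, hBg⟩ := Nat.exists_coprime k B
  generalize Nat.gcd k B = g at hQ hg hkr hBg ⊢
  rw [mul_comm] at hkr hBg
  have hr : 0 < r := Nat.pos_of_ne_zero fun h0 => by simp [h0] at hkr; omega
  rw [show k / g = r by rw [hkr, Nat.mul_div_cancel_left r hg]]
  have hx : IsCoprime ((h * B' : ℕ) : ℤ) (r : ℤ) := by
    refine Nat.Coprime.isCoprime (Nat.Coprime.mul_left ?_ hcop.symm)
    exact Nat.Coprime.coprime_dvd_right ⟨g, by rw [hkr, mul_comm]⟩ hghk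
  have hQ' : (g : ℤ) ∣ ((a * d + h * A : ℕ) : ℤ) := by exact_mod_cast hQ
  obtain ⟨i, hi, hdvd⟩ := exists_lt_mul_dvd_add_mul hr hx hQ'
  have hone : ∀ x y : ℤ, (k : ℤ) ∣ x * d + y → zeta x b * zeta y k = 1 := by
    intro x y hxy
    rwa [← zeta_mul_mul_right x b hd, ← hkd, ← zeta_add, zeta_eq_one_iff hk]
  have hden := card_filter_Icc_le hr hg hx n
    (P := fun m => zeta ((h : ℤ) * (B : ℤ) * (m : ℤ)) k = -1) (by
      intro m hm
      rw [← hkr, show (g : ℤ) * ((h * B' : ℕ) : ℤ) * m = h * B * m by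
        rw [hBg]; push_cast; ring]
      exact dvd_two_mul_of_zeta_eq_neg_one hk hm)
  have hnum := le_card_filter_range_of_modEq hr i n
    (P := fun j => zeta a b * zeta ((h : ℤ) * ((A : ℤ) + (B : ℤ) * (j : ℤ))) k = 1) (by
      intro j hj
      refine hone _ _ ?_
      obtain ⟨t, ht⟩ := hj.symm.dvd
      obtain ⟨s, hs⟩ := hdvd
      refine ⟨s + h * B' * t, ?_⟩
      rw [hkr, hBg]
      push_cast at hs ⊢
      linear_combination hs + (g : ℤ) * h * B' * ht)
  have hnum' := le_card_filter_range_of_modEq hr (r - 1 - i) n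
    (P := fun j => zeta (-(a : ℤ)) b *
      zeta ((h : ℤ) * ((B : ℤ) - (A : ℤ) + (B : ℤ) * (j : ℤ))) k = 1) (by
      intro j hj
      refine hone _ _ ?_
      obtain ⟨t, ht⟩ := hj.symm.dvd
      obtain ⟨s, hs⟩ := hdvd
      rw [show ((r - 1 - i : ℕ) : ℤ) = r - 1 - i by omega] at ht
      refine ⟨-s + h * B' * (t + 1), ?_⟩
      rw [hkr, hBg]
      push_cast at hs ⊢
      linear_combination -hs + (g : ℤ) * h * B' * ht)
  rw [Nat.mod_eq_of_lt (by omega : r / 2 - 1 < r)] at hden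
  rw [Nat.mod_eq_of_lt hi] at hnum
  rw [Nat.mod_eq_of_lt (by omega : r - 1 - i < r)] at hnum'
  rw [card_filter_bind_pure_natCast, card_filter_bind_pure_natCast, card_filter_bind_pure_natCast]
  have hnr := Nat.mod_lt n hr
  split_ifs at hden hnum hnum' <;> omega

end
end

section
/- Let τ ∈ ℂ with Im τ > 0 and z ∈ ℂ, and set q := e^{2πiτ}, ζ := e^{2πiz}. Assume z ∉ ℤτ + ℤ and 2z ∉ 2ℤτ + ℤ. Then g₂(ζ;q) = K(z;τ) − i e^{−πiτ/2} μ(2z, τ; 2τ). -/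
open scoped BigOperators Classical
open Filter Topology

noncomputable section

/-- The reciprocal `1 / (q;q)_m`, extended by zero to negative `m`. -/
def invPoch (q : ℂ) (m : ℤ) : ℂ := if m < 0 then 0 else (qPoch q q m.toNat)⁻¹

/-- The triangular number `k (k + 1) / 2`. -/
def tri (k : ℤ) : ℤ := k * (k + 1) / 2

lemma tri_add_one (k : ℤ) : tri (k + 1) = tri k + (k + 1) := by
  unfold tri
  rw [show (k + 1) * (k + 1 + 1) = k * (k + 1) + (k + 1) * 2 by ring,
    Int.add_mul_ediv_right _ _ (by norm_num)]

lemma two_mul_tri (k : ℤ) : 2 * tri k = k * (k + 1) :=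
  Int.two_mul_ediv_two_of_even (Int.even_mul_succ_self k)

lemma tri_neg_add_one (k : ℤ) : tri (-(k + 1)) = tri k := by
  unfold tri
  congr 1
  ring

lemma tri_natCast (n : ℕ) : tri n = (n * (n + 1) / 2 : ℕ) := by
  unfold tri
  push_cast
  rfl

lemma le_tri_natCast (n : ℕ) : n ≤ n * (n + 1) / 2 := by
  rw [Nat.le_div_iff_mul_le (by norm_num)]
  rcases n with _ | n
  · simp
  · nlinarith

lemma qPoch_succ (x q : ℂ) (n : ℕ) : qPoch x q (n + 1) = qPoch x q n * (1 - x * q ^ n) := by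
  simp [qPoch, Finset.prod_range_succ]

lemma one_sub_pow_ne_zero {q : ℂ} (hq : ‖q‖ < 1) {n : ℕ} (hn : n ≠ 0) : 1 - q ^ n ≠ 0 := by
  intro h
  have h1 : ‖q ^ n‖ = 1 := by rw [← sub_eq_zero.mp h]; simp
  rw [norm_pow] at h1
  exact (pow_lt_one₀ (norm_nonneg _) hq hn).ne h1

lemma one_sub_zpow_ne_zero {q : ℂ} (hq : ‖q‖ < 1) {n : ℤ} (hn : 0 < n) : 1 - q ^ n ≠ 0 := by
  lift n to ℕ using hn.le
  rw [zpow_natCast]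
  exact one_sub_pow_ne_zero hq (by omega)

lemma qPoch_self_ne_zero {q : ℂ} (hq : ‖q‖ < 1) (n : ℕ) : qPoch q q n ≠ 0 := by
  refine Finset.prod_ne_zero_iff.mpr fun j _ => ?_
  rw [← pow_succ']
  exact one_sub_pow_ne_zero hq (Nat.succ_ne_zero j)

lemma invPoch_of_neg (q : ℂ) {m : ℤ} (hm : m < 0) : invPoch q m = 0 := if_pos hm

lemma invPoch_natCast (q : ℂ) (n : ℕ) : invPoch q n = (qPoch q q n)⁻¹ := by
  simp [invPoch]

lemma invPoch_sub_one {q : ℂ} (hq : ‖q‖ < 1) (m : ℤ) :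
    invPoch q (m - 1) = (1 - q ^ m) * invPoch q m := by
  rcases lt_trichotomy m 0 with hm | rfl | hm
  · rw [invPoch_of_neg q hm, invPoch_of_neg q (by omega), mul_zero]
  · rw [invPoch_of_neg q (by omega)]
    simp
  · obtain ⟨n, rfl⟩ : ∃ n : ℕ, m = n + 1 := ⟨(m - 1).toNat, by omega⟩
    rw [add_sub_cancel_right, invPoch_natCast, ← Nat.cast_succ, invPoch_natCast, qPoch_succ,
      zpow_natCast, ← pow_succ']
    have h1 := one_sub_pow_ne_zero hq (Nat.succ_ne_zero n)
    have h2 := qPoch_self_ne_zero hq n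
    simp only [Nat.succ_eq_add_one] at h1 ⊢
    field_simp

lemma summable_norm_mul_pow (x : ℂ) {q : ℂ} (hq : ‖q‖ < 1) :
    Summable fun j : ℕ => ‖-(x * q ^ j)‖ := by
  simpa [norm_mul, norm_pow] using (summable_geometric_of_lt_one (norm_nonneg q) hq).mul_left ‖x‖

lemma multipliable_one_sub_mul_pow (x : ℂ) {q : ℂ} (hq : ‖q‖ < 1) :
    Multipliable fun j : ℕ => 1 - x * q ^ j := by
  simpa [sub_eq_add_neg] using multipliable_one_add_of_summable (summable_norm_mul_pow x hq)

lemma tendsto_qPoch (x : ℂ) {q : ℂ} (hq : ‖q‖ < 1) :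
    Tendsto (qPoch x q) atTop (𝓝 (qPochInf x q)) :=
  (multipliable_one_sub_mul_pow x hq).hasProd.tendsto_prod_nat

lemma qPochInf_ne_zero {x q : ℂ} (hq : ‖q‖ < 1) (h : ∀ j : ℕ, 1 - x * q ^ j ≠ 0) :
    qPochInf x q ≠ 0 := by
  have := tprod_one_add_ne_zero_of_summable (f := fun j : ℕ => -(x * q ^ j))
    (fun j => by simpa [sub_eq_add_neg] using h j) (summable_norm_mul_pow x hq)
  simpa [qPochInf, sub_eq_add_neg] using this

lemma qPochInf_self_ne_zero {q : ℂ} (hq : ‖q‖ < 1) : qPochInf q q ≠ 0 :=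
  qPochInf_ne_zero hq fun j => by
    rw [← pow_succ']
    exact one_sub_pow_ne_zero hq (Nat.succ_ne_zero j)

lemma tendsto_invPoch {q : ℂ} (hq : ‖q‖ < 1) :
    Tendsto (invPoch q) atTop (𝓝 (qPochInf q q)⁻¹) := by
  have h := (tendsto_qPoch q hq).inv₀ (qPochInf_self_ne_zero hq)
  have h2 : Tendsto Int.toNat atTop atTop := by
    refine tendsto_atTop.mpr fun b => ?_
    filter_upwards [eventually_ge_atTop (b : ℤ)] with m hm
    omega
  refine (h.comp h2).congr' ?_
  filter_upwards [eventually_ge_atTop 0] with m hm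
  simp [invPoch, not_lt.mpr hm]

lemma exists_norm_le_of_tendsto {u : ℕ → ℂ} {a : ℂ} (h : Tendsto u atTop (𝓝 a)) :
    ∃ C : ℝ, 0 < C ∧ ∀ n, ‖u n‖ ≤ C := by
  obtain ⟨C, hC⟩ := (Metric.isBounded_range_of_tendsto u h).exists_norm_le
  exact ⟨max C 1, by positivity, fun n => (hC _ ⟨n, rfl⟩).trans (le_max_left _ _)⟩

lemma exists_norm_invPoch_le {q : ℂ} (hq : ‖q‖ < 1) :
    ∃ C : ℝ, 0 < C ∧ ∀ m, ‖invPoch q m‖ ≤ C := by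
  obtain ⟨C, hC0, hC⟩ :=
    exists_norm_le_of_tendsto ((tendsto_invPoch hq).comp tendsto_natCast_atTop_atTop)
  refine ⟨C, hC0, fun m => ?_⟩
  rcases lt_or_ge m 0 with hm | hm
  · simpa [invPoch_of_neg q hm] using hC0.le
  · lift m to ℕ using hm
    exact hC m

lemma summable_pow_tri_nat {q : ℂ} (hq : ‖q‖ < 1) :
    Summable fun n : ℕ => ‖q‖ ^ (n * (n + 1) / 2) :=
  Summable.of_nonneg_of_le (fun n => by positivity)
    (fun n => pow_le_pow_of_le_one (norm_nonneg _) hq.le (le_tri_natCast n))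
    (summable_geometric_of_lt_one (norm_nonneg _) hq)

lemma summable_zpow_tri {q : ℂ} (hq : ‖q‖ < 1) : Summable fun k : ℤ => ‖q‖ ^ tri k := by
  apply Summable.of_nat_of_neg_add_one
  · simpa only [tri_natCast, zpow_natCast] using summable_pow_tri_nat hq
  · simpa only [tri_neg_add_one, tri_natCast, zpow_natCast] using summable_pow_tri_nat hq

lemma summable_mul_invPoch_window (q : ℂ) (f : ℤ → ℂ) (a b : ℤ) :
    Summable fun k => f k * (invPoch q (a - k) * invPoch q (b + k)) := by
  refine summable_of_ne_finset_zero (s := Finset.Icc (-b) a) fun k hk => ?_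
  rcases lt_or_ge k (-b) with h | h
  · rw [invPoch_of_neg q (show b + k < 0 by omega)]
    simp
  · have : a < k := by
      by_contra hka
      exact hk (Finset.mem_Icc.mpr ⟨h, by omega⟩)
    rw [invPoch_of_neg q (show a - k < 0 by omega)]
    simp

/-- The alternating sum of the `q`-binomial theorem, up to the factor `(q;q)_{a+b}`. -/
def binomSum (q : ℂ) (a b : ℤ) (z : ℂ) : ℂ :=
  ∑' k : ℤ, (-1) ^ k * q ^ tri k * z ^ k * (invPoch q (a - k) * invPoch q (b + k))

lemma binomSum_rec {q z : ℂ} (hq0 : q ≠ 0) (hq : ‖q‖ < 1) (hz : z ≠ 0) (a b : ℤ) :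
    (1 - q ^ (a + b)) * binomSum q a b z = (q ^ b - z * q) * binomSum q (a - 1) b (z * q) := by
  have hterm (k : ℤ) : (1 - q ^ (a + b)) *
        ((-1) ^ k * q ^ tri k * z ^ k * (invPoch q (a - k) * invPoch q (b + k))) =
      (-1) ^ k * q ^ tri k * z ^ k * (invPoch q (a - k) * invPoch q (b - 1 + k)) +
      q ^ b * ((-1) ^ k * q ^ tri k * (z * q) ^ k *
        (invPoch q (a - 1 - k) * invPoch q (b + k))) := by
    have h1 : q ^ (a + b) = q ^ (b + k) * q ^ (a - k) := by
      rw [← zpow_add₀ hq0]; congr 1; ring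
    rw [show b - 1 + k = b + k - 1 by ring, show a - 1 - k = a - k - 1 by ring,
      invPoch_sub_one hq, invPoch_sub_one hq, h1, mul_zpow, zpow_add₀ hq0 b k]
    ring
  have hshift : ∑' k : ℤ, (-1) ^ k * q ^ tri k * z ^ k *
        (invPoch q (a - k) * invPoch q (b - 1 + k)) =
      -(z * q) * binomSum q (a - 1) b (z * q) := by
    rw [binomSum, ← (Equiv.addRight (1 : ℤ)).tsum_eq, ← tsum_mul_left]
    refine tsum_congr fun k => ?_
    simp only [Equiv.coe_addRight]
    rw [tri_add_one, show a - (k + 1) = a - 1 - k by ring, show b - 1 + (k + 1) = b + k by ring,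
      zpow_add₀ hq0, zpow_add₀ hq0, zpow_add₀ hz, zpow_add₀ (by norm_num : (-1 : ℂ) ≠ 0), mul_zpow]
    simp only [zpow_one]
    ring
  conv_lhs => rw [binomSum, ← tsum_mul_left, tsum_congr hterm]
  rw [Summable.tsum_add (summable_mul_invPoch_window q _ a (b - 1))
    ((summable_mul_invPoch_window q _ (a - 1) b).mul_left _), hshift, tsum_mul_left]
  rw [← binomSum]
  ring

lemma binomSum_eq_zero {q : ℂ} (hq0 : q ≠ 0) (hq : ‖q‖ < 1) (b : ℤ) (s : ℕ) (a : ℤ)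
    (h : 1 ≤ a + b - s) : binomSum q a b (q ^ (b - 1 - s)) = 0 := by
  induction s generalizing a with
  | zero =>
    have := binomSum_rec hq0 hq (zpow_ne_zero (b - 1) hq0) a b
    rw [← zpow_add_one₀ hq0, sub_add_cancel, sub_self, zero_mul] at this
    simpa using (mul_eq_zero.mp this).resolve_left (one_sub_zpow_ne_zero hq (by simp at h; omega))
  | succ s ih =>
    push_cast at h ⊢
    have := binomSum_rec hq0 hq (zpow_ne_zero (b - 1 - (s + 1)) hq0) a b
    rw [← zpow_add_one₀ hq0, show b - 1 - (s + 1) + 1 = b - 1 - (s : ℤ) by ring,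
      ih (a - 1) (by omega), mul_zero] at this
    exact (mul_eq_zero.mp this).resolve_left (one_sub_zpow_ne_zero hq (by omega))

lemma one_sub_inv_mul_mul_pow_ne_zero {q x : ℂ} (hq0 : q ≠ 0) (hx : x ≠ 0)
    (hxq : ∀ k : ℤ, 1 - x * q ^ k ≠ 0) (j : ℕ) : 1 - x⁻¹ * q * q ^ j ≠ 0 := by
  intro h
  refine hxq (-(j + 1 : ℕ)) ?_
  rw [zpow_neg, zpow_natCast]
  field_simp at h ⊢
  linear_combination -h

/-- The partial fraction expansion of `1 / ((x;q)_n (q/x;q)_n)`. -/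
lemma inv_qPoch_mul_qPoch {q x : ℂ} (hq0 : q ≠ 0) (hq : ‖q‖ < 1) (hx : x ≠ 0)
    (hxq : ∀ k : ℤ, 1 - x * q ^ k ≠ 0) (n : ℕ) :
    (qPoch x q (n + 1) * qPoch (x⁻¹ * q) q (n + 1))⁻¹ =
      ∑' k : ℤ, (-1) ^ k * q ^ tri k / (1 - x * q ^ k) *
        (invPoch q (n - k) * invPoch q (n + 1 + k)) := by
  induction n with
  | zero =>
    rw [tsum_eq_sum (s := {0, -1})]
    · have h1 : invPoch q 1 = (1 - q)⁻¹ := by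
        simpa [qPoch] using invPoch_natCast q 1
      have h0 : invPoch q 0 = 1 := by
        simpa [qPoch] using invPoch_natCast q 0
      have e0 : 1 - x ≠ 0 := by simpa using hxq 0
      have e1 : 1 - x / q ≠ 0 := by simpa [div_eq_mul_inv] using hxq (-1)
      have e2 : q - x ≠ 0 := fun h => e1 (by rw [← sub_eq_zero.mp h, div_self hq0, sub_self])
      have e3 : 1 - q ≠ 0 := by simpa using one_sub_pow_ne_zero hq one_ne_zero
      have e4 : x - q ≠ 0 := fun h => e2 (by linear_combination -h)
      have e5 : 1 - x⁻¹ * q = (x - q) / x := by field_simp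
      rw [Finset.sum_pair (by norm_num)]
      simp only [qPoch, tri]
      simp [h0, h1, e5, ← div_eq_mul_inv]
      field_simp
      ring
    · intro k hk
      simp only [Finset.mem_insert, Finset.mem_singleton, not_or] at hk
      rcases lt_or_ge k 0 with h | h
      · rw [invPoch_of_neg q (show ((0 : ℕ) : ℤ) + 1 + k < 0 by push_cast; omega)]
        simp
      · rw [invPoch_of_neg q (show ((0 : ℕ) : ℤ) - k < 0 by push_cast; omega)]
        simp
  | succ n ih =>
    have hA : 1 - x * q ^ (n + 1) ≠ 0 := by
      simpa only [zpow_natCast] using hxq (n + 1 : ℕ)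
    have hB : 1 - x⁻¹ * q * q ^ (n + 1) ≠ 0 :=
      one_sub_inv_mul_mul_pow_ne_zero hq0 hx hxq (n + 1)
    rw [qPoch_succ x, qPoch_succ (x⁻¹ * q)]
    rw [show ∀ A B C D : ℂ, (A * B * (C * D))⁻¹ = (A * C)⁻¹ * (B * D)⁻¹ by
      intros; simp only [mul_inv]; ring, ih]
    rw [← div_eq_mul_inv, div_eq_iff (mul_ne_zero hA hB), ← tsum_mul_right]
    have hz1 : binomSum q (n + 1 : ℕ) (n + 2 : ℕ) 1 = 0 := by
      have := binomSum_eq_zero hq0 hq (n + 2 : ℕ) (n + 1) (n + 1 : ℕ) (by push_cast; omega)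
      rwa [show ((n + 2 : ℕ) : ℤ) - 1 - (n + 1 : ℕ) = 0 by push_cast; ring, zpow_zero] at this
    have hz2 : binomSum q (n + 1 : ℕ) (n + 2 : ℕ) q⁻¹ = 0 := by
      have := binomSum_eq_zero hq0 hq (n + 2 : ℕ) (n + 2) (n + 1 : ℕ) (by push_cast; omega)
      rwa [show ((n + 2 : ℕ) : ℤ) - 1 - (n + 2 : ℕ) = -1 by ring, zpow_neg_one] at this
    have key (k : ℤ) : (-1) ^ k * q ^ tri k / (1 - x * q ^ k) *
          (invPoch q ((n + 1 : ℕ) - k) * invPoch q ((n + 1 : ℕ) + 1 + k)) *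
          ((1 - x * q ^ (n + 1)) * (1 - x⁻¹ * q * q ^ (n + 1))) =
        (-1) ^ k * q ^ tri k / (1 - x * q ^ k) *
          (invPoch q (n - k) * invPoch q (n + 1 + k)) +
        (q ^ (n + 1) * ((-1) ^ k * q ^ tri k * q⁻¹ ^ k *
            (invPoch q ((n + 1 : ℕ) - k) * invPoch q ((n + 2 : ℕ) + k))) -
          x⁻¹ * q ^ (n + 2) * ((-1) ^ k * q ^ tri k * 1 ^ k *
            (invPoch q ((n + 1 : ℕ) - k) * invPoch q ((n + 2 : ℕ) + k)))) := by
      have e1 := invPoch_sub_one hq ((n + 1 : ℕ) - k)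
      have e2 := invPoch_sub_one hq ((n + 2 : ℕ) + k)
      rw [show ((n + 1 : ℕ) : ℤ) - k - 1 = n - k by push_cast; ring] at e1
      rw [show ((n + 2 : ℕ) : ℤ) + k - 1 = n + 1 + k by push_cast; ring] at e2
      rw [e1, e2, show ((n + 1 : ℕ) : ℤ) + 1 + k = (n + 2 : ℕ) + k by push_cast; ring,
        zpow_sub₀ hq0, zpow_add₀ hq0, zpow_natCast, zpow_natCast, one_zpow, inv_zpow]
      have hk := hxq k
      have hqk := zpow_ne_zero k hq0
      field_simp
      ring
    rw [tsum_congr key, Summable.tsum_add (summable_mul_invPoch_window q _ _ _)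
      (((summable_mul_invPoch_window q _ _ _).mul_left _).sub
        ((summable_mul_invPoch_window q _ _ _).mul_left _)),
      Summable.tsum_sub ((summable_mul_invPoch_window q _ _ _).mul_left _)
        ((summable_mul_invPoch_window q _ _ _).mul_left _), tsum_mul_left, tsum_mul_left]
    rw [← binomSum, ← binomSum, hz1, hz2]
    ring

lemma exists_norm_inv_one_sub_le {q x : ℂ} (hq0 : q ≠ 0) (hq : ‖q‖ < 1) (hx : x ≠ 0) :
    ∃ C : ℝ, 0 < C ∧ ∀ k : ℤ, ‖(1 - x * q ^ k)⁻¹‖ ≤ C := by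
  have hpow := tendsto_pow_atTop_nhds_zero_of_norm_lt_one hq
  have h1 : Tendsto (fun n : ℕ => (1 - x * q ^ n)⁻¹) atTop (𝓝 (1 - x * 0)⁻¹) :=
    ((hpow.const_mul x).const_sub 1).inv₀ (by simp)
  have h2 : Tendsto (fun n : ℕ => q ^ n * (q ^ n - x)⁻¹) atTop (𝓝 (0 * (0 - x)⁻¹)) :=
    hpow.mul ((hpow.sub_const x).inv₀ (by simpa using hx))
  obtain ⟨C, hC0, hC⟩ := exists_norm_le_of_tendsto h1
  obtain ⟨D, -, hD⟩ := exists_norm_le_of_tendsto h2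
  refine ⟨max C D, lt_max_of_lt_left hC0, fun k => ?_⟩
  obtain ⟨n, rfl | rfl⟩ := k.eq_nat_or_neg
  · rw [zpow_natCast]
    exact (hC n).trans (le_max_left _ _)
  · refine le_trans (le_of_eq ?_) ((hD n).trans (le_max_right _ _))
    have hn := pow_ne_zero n hq0
    congr 1
    rw [zpow_neg, zpow_natCast, show 1 - x * (q ^ n)⁻¹ = (q ^ n - x) / q ^ n by field_simp, inv_div,
      div_eq_mul_inv]

lemma norm_appell_term (q x : ℂ) (k : ℤ) :
    ‖(-1) ^ k * q ^ tri k / (1 - x * q ^ k)‖ = ‖q‖ ^ tri k * ‖(1 - x * q ^ k)⁻¹‖ := by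
  simp [div_eq_mul_inv]

/-- The partial fraction expansion of the reciprocal theta function. -/
lemma tsum_div_one_sub_eq {q x : ℂ} (hq0 : q ≠ 0) (hq : ‖q‖ < 1) (hx : x ≠ 0)
    (hxq : ∀ k : ℤ, 1 - x * q ^ k ≠ 0) :
    ∑' k : ℤ, (-1) ^ k * q ^ tri k / (1 - x * q ^ k) =
      qPochInf q q ^ 2 / (qPochInf x q * qPochInf (x⁻¹ * q) q) := by
  have hA : qPochInf x q ≠ 0 :=
    qPochInf_ne_zero hq fun j => by simpa only [zpow_natCast] using hxq j
  have hB : qPochInf (x⁻¹ * q) q ≠ 0 :=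
    qPochInf_ne_zero hq (one_sub_inv_mul_mul_pow_ne_zero hq0 hx hxq)
  obtain ⟨C, hC0, hC⟩ := exists_norm_invPoch_le hq
  obtain ⟨D, hD0, hD⟩ := exists_norm_inv_one_sub_le hq0 hq hx
  have hl : Tendsto (fun n : ℕ => (qPoch x q (n + 1) * qPoch (x⁻¹ * q) q (n + 1))⁻¹) atTop
      (𝓝 (qPochInf x q * qPochInf (x⁻¹ * q) q)⁻¹) :=
    ((((tendsto_qPoch x hq).mul (tendsto_qPoch (x⁻¹ * q) hq)).inv₀ (mul_ne_zero hA hB)).comp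
      (tendsto_add_atTop_nat 1))
  have hr : Tendsto (fun n : ℕ => ∑' k : ℤ, (-1) ^ k * q ^ tri k / (1 - x * q ^ k) *
      (invPoch q (n - k) * invPoch q (n + 1 + k))) atTop
      (𝓝 (∑' k : ℤ, (-1) ^ k * q ^ tri k / (1 - x * q ^ k) *
        ((qPochInf q q)⁻¹ * (qPochInf q q)⁻¹))) := by
    refine tendsto_tsum_of_dominated_convergence
      (bound := fun k : ℤ => ‖q‖ ^ tri k * (D * (C * C)))
      ((summable_zpow_tri hq).mul_right _) (fun k => ?_) (Eventually.of_forall fun n k => ?_)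
    · have h1 : Tendsto (fun n : ℕ => (n : ℤ) - k) atTop atTop := by
        simpa [sub_eq_add_neg] using
          tendsto_atTop_add_const_right atTop (-k) (tendsto_natCast_atTop_atTop (R := ℤ))
      have h2 : Tendsto (fun n : ℕ => (n : ℤ) + 1 + k) atTop atTop := by
        simpa [add_assoc] using
          tendsto_atTop_add_const_right atTop (1 + k) (tendsto_natCast_atTop_atTop (R := ℤ))
      exact (((tendsto_invPoch hq).comp h1).mul ((tendsto_invPoch hq).comp h2)).const_mul _
    · rw [norm_mul, norm_appell_term, norm_mul, mul_assoc]
      gcongr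
      exacts [hD k, hC _, hC _]
  have := tendsto_nhds_unique hl (hr.congr fun n => (inv_qPoch_mul_qPoch hq0 hq hx hxq n).symm)
  rw [tsum_mul_right] at this
  have hQ := qPochInf_self_ne_zero hq
  field_simp at this ⊢
  linear_combination -this

lemma exists_norm_qPoch_le (x : ℂ) {q : ℂ} (hq : ‖q‖ < 1) :
    ∃ C : ℝ, 0 < C ∧ ∀ n, ‖qPoch x q n‖ ≤ C :=
  exists_norm_le_of_tendsto (tendsto_qPoch x hq)

lemma summable_conjBailey_term {q : ℂ} (hq : ‖q‖ < 1) (a b : ℤ) :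
    Summable fun n : ℕ => qPoch (-q) q n * q ^ (n * (n + 1) / 2) *
      (invPoch q (n - a) * invPoch q (n + b)) := by
  obtain ⟨C, hC0, hC⟩ := exists_norm_invPoch_le hq
  obtain ⟨D, hD0, hD⟩ := exists_norm_qPoch_le (-q) hq
  refine Summable.of_norm_bounded
    (((summable_pow_tri_nat hq).mul_left D).mul_right (C * C)) fun n => ?_
  rw [norm_mul, norm_mul, norm_mul, norm_pow]
  gcongr
  exacts [hD n, hC _, hC _]

/-- The conjugate Bailey sum attached to `(-q;q)_n q^{n(n+1)/2}`. -/
def conjBailey (q : ℂ) (k : ℤ) : ℂ :=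
  ∑' n : ℕ, qPoch (-q) q n * q ^ (n * (n + 1) / 2) * (invPoch q (n - k) * invPoch q (n + (k + 1)))

lemma tri_nat_succ (n : ℕ) : (n + 1) * (n + 1 + 1) / 2 = n * (n + 1) / 2 + (n + 1) := by
  rw [show (n + 1) * (n + 1 + 1) = n * (n + 1) + (n + 1) * 2 by ring,
    Nat.add_mul_div_right _ _ (by norm_num)]

lemma conjBailey_add_one {q : ℂ} (hq0 : q ≠ 0) (hq : ‖q‖ < 1) (k : ℤ) :
    conjBailey q (k + 1) = q ^ (k + 1) * conjBailey q k := by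
  set G : ℕ → ℂ := fun n => -(1 - q ^ (k + 1)) * (qPoch (-q) q n * q ^ (n * (n + 1) / 2) *
    (invPoch q (n - (k + 1)) * invPoch q (n + (k + 1)))) with hG
  have hs1 := summable_conjBailey_term hq (k + 1) (k + 1 + 1)
  have hs2 := (summable_conjBailey_term hq k (k + 1)).mul_left (q ^ (k + 1))
  have hterm (n : ℕ) : qPoch (-q) q n * q ^ (n * (n + 1) / 2) *
        (invPoch q (n - (k + 1)) * invPoch q (n + (k + 1 + 1))) -
      q ^ (k + 1) * (qPoch (-q) q n * q ^ (n * (n + 1) / 2) *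
        (invPoch q (n - k) * invPoch q (n + (k + 1)))) = G (n + 1) - G n := by
    have e1 := invPoch_sub_one hq (n - k)
    have e2 := invPoch_sub_one hq (n + (k + 1 + 1))
    rw [show (n : ℤ) - k - 1 = n - (k + 1) by ring] at e1
    rw [show (n : ℤ) + (k + 1 + 1) - 1 = n + (k + 1) by ring] at e2
    simp only [hG]
    rw [show ((n + 1 : ℕ) : ℤ) - (k + 1) = n - k by push_cast; ring,
      show ((n + 1 : ℕ) : ℤ) + (k + 1) = n + (k + 1 + 1) by push_cast; ring, e1, e2, qPoch_succ,
      tri_nat_succ, zpow_sub₀ hq0, zpow_add₀ hq0 (n : ℤ), zpow_add₀ hq0 (k + 1), zpow_add₀ hq0 k,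
      zpow_natCast, zpow_one, pow_add, pow_add]
    have hk := zpow_ne_zero k hq0
    field_simp
    ring
  have hG0 : G 0 = 0 := by
    simp only [hG]
    rcases lt_trichotomy (k + 1) 0 with h | h | h
    · rw [invPoch_of_neg q (show ((0 : ℕ) : ℤ) + (k + 1) < 0 by push_cast; omega)]
      ring
    · rw [h]
      simp
    · rw [invPoch_of_neg q (show ((0 : ℕ) : ℤ) - (k + 1) < 0 by push_cast; omega)]
      ring
  have hlim : Tendsto G atTop (𝓝 0) :=
    ((summable_conjBailey_term hq (k + 1) (k + 1)).mul_left _).tendsto_atTop_zero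
  have h := (hs1.sub hs2).hasSum.tendsto_sum_nat
  simp only [hterm, Finset.sum_range_sub, hG0, sub_zero] at h
  have h0 := tendsto_nhds_unique h hlim
  rw [← tsum_congr hterm, Summable.tsum_sub hs1 hs2, tsum_mul_left] at h0
  exact sub_eq_zero.mp h0

lemma conjBailey_eq {q : ℂ} (hq0 : q ≠ 0) (hq : ‖q‖ < 1) (k : ℤ) :
    conjBailey q k = q ^ tri k * conjBailey q 0 := by
  induction k using Int.induction_on with
  | zero => simp [tri]
  | succ k ih => rw [conjBailey_add_one hq0 hq, ih, tri_add_one, zpow_add₀ hq0 (tri k)]; ring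
  | pred k ih =>
    have h := conjBailey_add_one hq0 hq (-(k : ℤ) - 1)
    have ht := tri_add_one (-(k : ℤ) - 1)
    rw [sub_add_cancel] at h ht
    rw [ih, ht, zpow_add₀ hq0, mul_right_comm, mul_comm] at h
    exact (mul_left_cancel₀ (zpow_ne_zero _ hq0) h).symm

lemma tri_nat_add (m n : ℕ) :
    (m + n) * (m + n + 1) / 2 = n * (n + 1) / 2 + (n * m + m * (m + 1) / 2) := by
  have h1 := Nat.div_mul_cancel (Nat.even_mul_succ_self (m + n)).two_dvd
  have h2 := Nat.div_mul_cancel (Nat.even_mul_succ_self n).two_dvd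
  have h3 := Nat.div_mul_cancel (Nat.even_mul_succ_self m).two_dvd
  refine Nat.eq_of_mul_eq_mul_right (show 0 < 2 by norm_num) ?_
  rw [h1, add_mul (n * (n + 1) / 2), add_mul (n * m), h2, h3]
  ring

lemma conjBailey_zero {q : ℂ} (hq0 : q ≠ 0) (hq : ‖q‖ < 1) :
    conjBailey q 0 = qPochInf (-q) q / qPochInf q q := by
  obtain ⟨C, hC0, hC⟩ := exists_norm_invPoch_le hq
  obtain ⟨D, hD0, hD⟩ := exists_norm_qPoch_le (-q) hq
  have hshift (K : ℕ) : conjBailey q 0 = ∑' m : ℕ, qPoch (-q) q (m + K) *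
      (q ^ (K * m) * q ^ (m * (m + 1) / 2)) * (invPoch q m * invPoch q (m + (2 * K + 1))) := by
    have h := conjBailey_eq hq0 hq K
    rw [conjBailey, ← Summable.sum_add_tsum_nat_add K (summable_conjBailey_term hq K (K + 1)),
      Finset.sum_eq_zero, zero_add] at h
    · refine mul_left_cancel₀ (zpow_ne_zero (tri K) hq0) ?_
      rw [← h, ← tsum_mul_left]
      refine tsum_congr fun m => ?_
      rw [tri_natCast, zpow_natCast, tri_nat_add, pow_add, pow_add,
        show ((m + K : ℕ) : ℤ) - K = m by push_cast; ring,
        show ((m + K : ℕ) : ℤ) + (K + 1) = m + (2 * K + 1) by push_cast; ring]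
      ring
    · intro n hn
      rw [Finset.mem_range] at hn
      rw [invPoch_of_neg q (show (n : ℤ) - K < 0 by omega)]
      ring
  have hlim : Tendsto (fun K : ℕ => ∑' m : ℕ, qPoch (-q) q (m + K) *
      (q ^ (K * m) * q ^ (m * (m + 1) / 2)) * (invPoch q m * invPoch q (m + (2 * K + 1)))) atTop
      (𝓝 (∑' m : ℕ, if m = 0 then qPochInf (-q) q / qPochInf q q else 0)) := by
    refine tendsto_tsum_of_dominated_convergence
      (bound := fun m : ℕ => D * (1 * ‖q‖ ^ (m * (m + 1) / 2)) * (C * C))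
      ((((summable_pow_tri_nat hq).mul_left 1).mul_left D).mul_right (C * C))
      (fun m => ?_) (Eventually.of_forall fun K m => ?_)
    · have h1 : Tendsto (fun K : ℕ => (m : ℤ) + (2 * K + 1)) atTop atTop := by
        refine tendsto_atTop_mono (fun K => ?_) (tendsto_natCast_atTop_atTop (R := ℤ))
        omega
      have h2 : Tendsto (fun K : ℕ => qPoch (-q) q (m + K)) atTop (𝓝 (qPochInf (-q) q)) := by
        simpa only [Function.comp_def, add_comm] using
          (tendsto_qPoch (-q) hq).comp (tendsto_add_atTop_nat m)
      have h3 := (tendsto_invPoch hq).comp h1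
      by_cases hm : m = 0
      · subst hm
        have h0 : invPoch q 0 = 1 := by simpa [qPoch] using invPoch_natCast q 0
        simpa [h0, div_eq_mul_inv] using h2.mul h3
      · have h4 : Tendsto (fun K : ℕ => q ^ (K * m)) atTop (𝓝 0) := by
          refine (tendsto_pow_atTop_nhds_zero_of_norm_lt_one hq).comp
            (tendsto_atTop_mono (fun K => ?_) tendsto_id)
          exact Nat.le_mul_of_pos_right K (Nat.pos_of_ne_zero hm)
        simpa [hm] using (h2.mul (h4.mul_const (q ^ (m * (m + 1) / 2)))).mul
          (h3.const_mul (invPoch q m))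
    · rw [norm_mul, norm_mul, norm_mul, norm_mul, norm_pow, norm_pow]
      gcongr
      exacts [hD _, pow_le_one₀ (norm_nonneg _) hq.le, hC _, hC _]
  rw [tsum_ite_eq] at hlim
  exact tendsto_nhds_unique (tendsto_const_nhds.congr hshift) hlim

/-- The Appell–Lerch sum representation of the universal mock theta function `g2`. -/
lemma g2_eq_tsum {q x : ℂ} (hq0 : q ≠ 0) (hq : ‖q‖ < 1) (hx : x ≠ 0)
    (hxq : ∀ k : ℤ, 1 - x * q ^ k ≠ 0) :
    g2 x q = qPochInf (-q) q / qPochInf q q *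
      ∑' k : ℤ, (-1) ^ k * (q ^ tri k) ^ 2 / (1 - x * q ^ k) := by
  obtain ⟨C, hC0, hC⟩ := exists_norm_invPoch_le hq
  obtain ⟨D, hD0, hD⟩ := exists_norm_inv_one_sub_le hq0 hq hx
  obtain ⟨E, hE0, hE⟩ := exists_norm_qPoch_le (-q) hq
  have hsum : Summable (Function.uncurry fun (n : ℕ) (k : ℤ) =>
      qPoch (-q) q n * q ^ (n * (n + 1) / 2) * ((-1) ^ k * q ^ tri k / (1 - x * q ^ k) *
        (invPoch q (n - k) * invPoch q (n + 1 + k)))) := by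
    refine Summable.of_norm_bounded (((summable_pow_tri_nat hq).mul_of_nonneg
      (summable_zpow_tri hq) (fun n => by positivity) (fun k => by positivity)).mul_left
        (E * (D * (C * C)))) ?_
    rintro ⟨n, k⟩
    rw [Function.uncurry_apply_pair, norm_mul, norm_mul, norm_mul, norm_appell_term, norm_mul,
      norm_pow]
    calc _ ≤ E * ‖q‖ ^ (n * (n + 1) / 2) * (‖q‖ ^ tri k * D * (C * C)) := by
          gcongr
          exacts [hE n, hD k, hC _, hC _]
      _ = _ := by ring
  calc g2 x q = ∑' (n : ℕ) (k : ℤ), qPoch (-q) q n * q ^ (n * (n + 1) / 2) *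
        ((-1) ^ k * q ^ tri k / (1 - x * q ^ k) *
          (invPoch q (n - k) * invPoch q (n + 1 + k))) := by
        refine tsum_congr fun n => ?_
        rw [tsum_mul_left, ← inv_qPoch_mul_qPoch hq0 hq hx hxq, div_eq_mul_inv]
    _ = ∑' (k : ℤ) (n : ℕ), qPoch (-q) q n * q ^ (n * (n + 1) / 2) *
        ((-1) ^ k * q ^ tri k / (1 - x * q ^ k) *
          (invPoch q (n - k) * invPoch q (n + 1 + k))) := hsum.tsum_comm.symm
    _ = _ := by
        rw [← tsum_mul_left]
        refine tsum_congr fun k => ?_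
        rw [← conjBailey_zero hq0 hq]
        have h := conjBailey_eq hq0 hq k
        rw [show conjBailey q 0 * ((-1) ^ k * (q ^ tri k) ^ 2 / (1 - x * q ^ k)) =
          (-1) ^ k * q ^ tri k / (1 - x * q ^ k) * (q ^ tri k * conjBailey q 0) by ring, ← h,
          conjBailey, ← tsum_mul_left]
        refine tsum_congr fun n => ?_
        rw [show (n : ℤ) + 1 + k = n + (k + 1) by ring]
        ring

lemma qPochInf_sq_sq {q : ℂ} (hq : ‖q‖ < 1) :
    qPochInf (q ^ 2) (q ^ 2) = qPochInf q q * qPochInf (-q) q := by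
  rw [qPochInf, qPochInf, qPochInf, ← Multipliable.tprod_mul (multipliable_one_sub_mul_pow q hq)
    (multipliable_one_sub_mul_pow (-q) hq)]
  exact tprod_congr fun j => by ring

lemma qPochInf_self_eq {q : ℂ} (hq : ‖q‖ < 1) :
    qPochInf q q = qPochInf q (q ^ 2) * qPochInf (q ^ 2) (q ^ 2) := by
  have hq2 : ‖q ^ 2‖ < 1 := by
    rw [norm_pow]
    exact pow_lt_one₀ (norm_nonneg _) hq two_ne_zero
  have he (k : ℕ) : 1 - q * (q ^ 2) ^ k = 1 - q * q ^ (2 * k) := by ring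
  have ho (k : ℕ) : 1 - q ^ 2 * (q ^ 2) ^ k = 1 - q * q ^ (2 * k + 1) := by ring
  have h1 := multipliable_one_sub_mul_pow q hq2
  have h2 := multipliable_one_sub_mul_pow (q ^ 2) hq2
  simp only [qPochInf, he, ho] at h1 h2 ⊢
  exact (tprod_even_mul_odd (f := fun j : ℕ => 1 - q * q ^ j) h1 h2).symm

lemma ee_add (x y : ℂ) : ee (x + y) = ee x * ee y := by
  rw [ee, mul_add, Complex.exp_add, ee, ee]

lemma ee_int_mul (n : ℤ) (x : ℂ) : ee (n * x) = ee x ^ n := by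
  rw [ee, ee, ← Complex.exp_int_mul]
  congr 1
  ring

lemma ee_two_mul (x : ℂ) : ee (2 * x) = ee x ^ 2 := by
  rw [two_mul, ee_add, sq]

lemma ee_eq_one_iff (x : ℂ) : ee x = 1 ↔ ∃ n : ℤ, x = n := by
  rw [ee, Complex.exp_eq_one_iff]
  refine exists_congr fun n => ?_
  rw [mul_comm, mul_left_inj' Complex.two_pi_I_ne_zero]

lemma norm_ee_lt_one {τ : ℂ} (hτ : 0 < τ.im) : ‖ee τ‖ < 1 := by
  rw [ee, Complex.norm_exp, Real.exp_lt_one_iff]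
  have : (2 * Real.pi * Complex.I * τ).re = -(2 * Real.pi * τ.im) := by simp
  rw [this]
  have := Real.pi_pos
  simp only [Left.neg_neg_iff]
  positivity

lemma one_sub_ee_mul_zpow_ne_zero {w σ : ℂ} (h : ¬∃ m n : ℤ, w = m * σ + n) (k : ℤ) :
    1 - ee w * ee σ ^ k ≠ 0 := by
  intro h0
  rw [← ee_int_mul, ← ee_add] at h0
  obtain ⟨n, hn⟩ := (ee_eq_one_iff _).mp (sub_eq_zero.mp h0).symm
  exact h ⟨-k, n, by push_cast; linear_combination hn⟩

/-- Splitting the Appell–Lerch sum of `g2` by `1 / (1 - y) = (1 + y) / (1 - y ^ 2)`. -/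
lemma tsum_split {q x : ℂ} (hq0 : q ≠ 0) (hq : ‖q‖ < 1) (hx : x ≠ 0)
    (hxq : ∀ k : ℤ, 1 - x * q ^ k ≠ 0) (hxq2 : ∀ k : ℤ, 1 - x ^ 2 * (q ^ 2) ^ k ≠ 0) :
    ∑' k : ℤ, (-1) ^ k * (q ^ tri k) ^ 2 / (1 - x * q ^ k) =
      ∑' k : ℤ, (-1) ^ k * (q ^ 2) ^ tri k / (1 - x ^ 2 * (q ^ 2) ^ k) +
      x * ∑' k : ℤ, (-q) ^ k * (q ^ 2) ^ tri k / (1 - x ^ 2 * (q ^ 2) ^ k) := by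
  have hq2 : ‖q ^ 2‖ < 1 := by
    rw [norm_pow]
    exact pow_lt_one₀ (norm_nonneg _) hq two_ne_zero
  obtain ⟨C, hC0, hC⟩ := exists_norm_inv_one_sub_le hq0 hq hx
  obtain ⟨D, hD0, hD⟩ := exists_norm_inv_one_sub_le (pow_ne_zero 2 hq0) hq2 (pow_ne_zero 2 hx)
  have hs1 : Summable fun k : ℤ => (-1) ^ k * (q ^ tri k) ^ 2 / (1 - x * q ^ k) := by
    refine Summable.of_norm_bounded ((summable_zpow_tri hq2).mul_right C) fun k => ?_
    rw [div_eq_mul_inv, norm_mul]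
    refine mul_le_mul (le_of_eq ?_) (hC k) (norm_nonneg _) (by positivity)
    rw [norm_mul, norm_zpow, norm_neg, norm_one, one_zpow, one_mul, norm_pow, norm_zpow, norm_pow,
      ← zpow_natCast, ← zpow_natCast, zpow_comm]
  have hs2 : Summable fun k : ℤ => (-1) ^ k * (q ^ 2) ^ tri k / (1 - x ^ 2 * (q ^ 2) ^ k) := by
    refine Summable.of_norm_bounded ((summable_zpow_tri hq2).mul_right D) fun k => ?_
    rw [norm_appell_term]
    gcongr
    exact hD k
  rw [← sub_eq_iff_eq_add', ← Summable.tsum_sub hs1 hs2, ← tsum_mul_left]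
  refine tsum_congr fun k => ?_
  have h1 := hxq k
  have h2 := hxq2 k
  have e1 : (q ^ 2) ^ k = (q ^ k) ^ 2 := by rw [← zpow_natCast, ← zpow_natCast, zpow_comm]
  have e2 : (q ^ 2) ^ tri k = (q ^ tri k) ^ 2 := by
    rw [← zpow_natCast, ← zpow_natCast, zpow_comm]
  have e3 : (-q) ^ k = (-1) ^ k * q ^ k := by rw [← mul_zpow, neg_one_mul]
  rw [e1] at h2 ⊢
  rw [e2, e3]
  have h3 : 1 + x * q ^ k ≠ 0 := fun h => h2 (by linear_combination (1 - x * q ^ k) * h)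
  rw [show 1 - x ^ 2 * (q ^ k) ^ 2 = (1 - x * q ^ k) * (1 + x * q ^ k) by ring]
  field_simp
  ring

lemma mu_tsum_eq (z τ : ℂ) :
    ∑' n : ℤ, (-(ee τ)) ^ n *
        Complex.exp (Real.pi * Complex.I * (n : ℂ) * ((n : ℂ) + 1) * (2 * τ)) /
        (1 - ee (2 * z) * (ee (2 * τ)) ^ n) =
    ∑' k : ℤ, (-(ee τ)) ^ k * (ee τ ^ 2) ^ tri k / (1 - ee z ^ 2 * (ee τ ^ 2) ^ k) := by
  refine tsum_congr fun k => ?_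
  have h : (2 : ℂ) * (tri k : ℂ) = k * (k + 1) := by exact_mod_cast two_mul_tri k
  rw [ee_two_mul, ee_two_mul]
  congr 2
  rw [← ee_two_mul, ← ee_int_mul, ee]
  congr 1
  linear_combination (-2 * Real.pi * Complex.I * τ) * h

/-- Lemma 2.4 (Kang): g₂ in terms of K and Zwegers' μ. -/
theorem statement8 (τ z : ℂ) (hτ : 0 < τ.im)
    (hz : ¬∃ m n : ℤ, z = (m : ℂ) * τ + (n : ℂ))
    (h2z : ¬∃ m n : ℤ, 2 * z = 2 * (m : ℂ) * τ + (n : ℂ)) :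
    g2 (ee z) (ee τ) =
      Kfun z τ - Complex.I * Complex.exp (-(Real.pi * Complex.I * τ / 2)) * mu (2 * z) τ (2 * τ) := by
  have hq := norm_ee_lt_one hτ
  have hq0 : ee τ ≠ 0 := Complex.exp_ne_zero _
  have hx0 : ee z ≠ 0 := Complex.exp_ne_zero _
  have hxq := one_sub_ee_mul_zpow_ne_zero hz
  have hxq2 : ∀ k : ℤ, 1 - ee z ^ 2 * (ee τ ^ 2) ^ k ≠ 0 := by
    rw [← ee_two_mul, ← ee_two_mul]
    refine one_sub_ee_mul_zpow_ne_zero fun ⟨m, n, h⟩ => h2z ⟨m, n, ?_⟩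
    rw [h]
    ring
  have hq2 : ‖ee τ ^ 2‖ < 1 := by
    rw [norm_pow]
    exact pow_lt_one₀ (norm_nonneg _) hq two_ne_zero
  rw [g2_eq_tsum hq0 hq hx0 hxq, tsum_split hq0 hq hx0 hxq hxq2,
    tsum_div_one_sub_eq (pow_ne_zero 2 hq0) hq2 (pow_ne_zero 2 hx0) hxq2, Kfun, mu, mu_tsum_eq]
  simp only [theta, eta, ee_two_mul]
  set q := ee τ
  set x := ee z
  set s := Complex.exp (Real.pi * Complex.I * τ / 12) with hs
  have hs0 : s ≠ 0 := Complex.exp_ne_zero _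
  have e1 : Complex.exp (Real.pi * Complex.I * (2 * τ) / 12) = s ^ 2 := by
    rw [hs, ← Complex.exp_nat_mul]; congr 1; push_cast; ring
  have e2 : Complex.exp (Real.pi * Complex.I * (2 * τ) / 4) = s ^ 6 := by
    rw [hs, ← Complex.exp_nat_mul]; congr 1; push_cast; ring
  have e3 : Complex.exp (-(Real.pi * Complex.I * τ)) = (s ^ 12)⁻¹ := by
    rw [hs, ← Complex.exp_nat_mul, ← Complex.exp_neg]; congr 1; push_cast; ring
  have e4 : Complex.exp (-(Real.pi * Complex.I * τ / 2)) = (s ^ 6)⁻¹ := by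
    rw [hs, ← Complex.exp_nat_mul, ← Complex.exp_neg]; congr 1; push_cast; ring
  have e5 : Complex.exp (Real.pi * Complex.I * (2 * z)) = x := by
    simp only [x, ee]; congr 1; ring
  have e6 : Complex.exp (-(Real.pi * Complex.I * (2 * z))) = x⁻¹ := by
    rw [Complex.exp_neg, e5]
  have e7 : q⁻¹ * q ^ 2 = q := by field_simp
  have ha := qPochInf_self_ne_zero hq
  have hd := qPochInf_self_ne_zero hq2
  have hd1 := qPochInf_sq_sq hq
  have hd2 := qPochInf_self_eq hq
  have hA : qPochInf (x ^ 2) (q ^ 2) ≠ 0 :=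
    qPochInf_ne_zero hq2 fun j => by simpa only [zpow_natCast] using hxq2 j
  have hB : qPochInf ((x ^ 2)⁻¹ * q ^ 2) (q ^ 2) ≠ 0 :=
    qPochInf_ne_zero hq2
      (one_sub_inv_mul_mul_pow_ne_zero (pow_ne_zero 2 hq0) (pow_ne_zero 2 hx0) hxq2)
  rw [e1, e2, e3, e4, e5, e6, e7]
  have hI2 := Complex.I_sq
  generalize qPochInf (x ^ 2) (q ^ 2) = A at *
  generalize qPochInf ((x ^ 2)⁻¹ * q ^ 2) (q ^ 2) = B at *
  generalize (∑' k : ℤ, (-q) ^ k * (q ^ 2) ^ tri k / (1 - x ^ 2 * (q ^ 2) ^ k)) = T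
  generalize qPochInf (q ^ 2) (q ^ 2) = d at *
  generalize qPochInf q (q ^ 2) = c at *
  generalize qPochInf (-q) q = b at *
  generalize qPochInf q q = a at *
  have hc : c ≠ 0 := by
    rintro rfl
    exact ha (by rw [hd2, zero_mul])
  have hb : b = d / a := by rw [hd1]; field_simp
  subst hb hd2
  field_simp
  ring_nf
  simp only [hI2]
  ring

end
end
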